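/- arXiv:2104.11045 — 2 statements merged into one kernel-verified Lean document; each statement's English description precedes it below -/
import Mathlib

section
/- Let 1 ≤ k ≤ n. There exists a positive constant c_{n,k} depending only on n and k such that for every η = (η_1,…,η_n) ∈ Γ_k with η_1 ≥ η_2 ≥ ⋯ ≥ η_n, one has σ_{k−1}(η|k) ≥ c_{n,k} · Σ_{i=1}^n σ_{k−1}(η|i). -/
/-- The `m`-th elementary symmetric function of `x ∈ ℝⁿ`. -/
noncomputable def esym (n m : ℕ) (x : Fin n → ℝ) : ℝ :=
  ∑ s ∈ Finset.univ.powersetCard m, ∏ i ∈ s, x i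

/-- `σ_m(x|p)`: the `m`-th elementary symmetric function of the vector obtained from `x`
by deleting the entry `x p`. -/
noncomputable def esymDel (n m : ℕ) (x : Fin n → ℝ) (p : Fin n) : ℝ :=
  ∑ s ∈ (Finset.univ.erase p).powersetCard m, ∏ i ∈ s, x i

/-- The Gårding cone `Γ_k ⊂ ℝⁿ`. -/
def GardingCone (n k : ℕ) : Set (Fin n → ℝ) :=
  {x | ∀ i : ℕ, 1 ≤ i → i ≤ k → 0 < esym n i x}

namespace GardingAux

open Polynomial Finset

/-- Derivatives of real-rooted polynomials are real-rooted. -/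
lemma splits_derivative {p : ℝ[X]} (hp : p.Splits) : (derivative p).Splits := by
  rw [splits_iff_card_roots] at *
  have h1 := card_roots_le_derivative p
  have h2 := card_roots' (derivative p)
  by_cases h0 : p.natDegree = 0
  · rw [eq_C_of_natDegree_eq_zero h0]; simp
  · have h3 := natDegree_derivative_lt h0
    omega

lemma splits_iterate {p : ℝ[X]} (hp : p.Splits) (m : ℕ) : (derivative^[m] p).Splits := by
  induction m with
  | zero => simpa using hp
  | succ m ih => rw [Function.iterate_succ_apply']; exact splits_derivative ih

lemma laguerre {p : ℝ[X]} (hp : p.Splits) :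
    2 * p.coeff 0 * p.coeff 2 ≤ p.coeff 1 ^ 2 := by
  obtain ⟨m, hm⟩ := splits_iff_exists_multiset'.1 hp
  have key : ∀ m : Multiset ℝ, 2 * (m.map (X + C ·)).prod.coeff 0 * (m.map (X + C ·)).prod.coeff 2
      ≤ (m.map (X + C ·)).prod.coeff 1 ^ 2 := by
    intro m
    induction m using Multiset.induction_on with
    | empty => simp [coeff_one]
    | cons r m ih =>
      simp only [Multiset.map_cons, Multiset.prod_cons]
      set R := (m.map (X + C ·)).prod
      have e0 : ((X + C r) * R).coeff 0 = r * R.coeff 0 := by simp [add_mul]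
      have e1 : ((X + C r) * R).coeff 1 = R.coeff 0 + r * R.coeff 1 := by
        simp [add_mul, coeff_X_mul]
      have e2 : ((X + C r) * R).coeff 2 = R.coeff 1 + r * R.coeff 2 := by
        simp [add_mul, coeff_X_mul]
      rw [e0, e1, e2]
      nlinarith [sq_nonneg (R.coeff 0), mul_le_mul_of_nonneg_left ih (sq_nonneg r)]
  rw [hm]
  simp only [coeff_C_mul]
  nlinarith [mul_le_mul_of_nonneg_left (key m) (sq_nonneg p.leadingCoeff)]

lemma newton_poly {p : ℝ[X]} (hp : p.Splits) (m : ℕ) :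
    ((m : ℝ) + 2) * (p.coeff m * p.coeff (m + 2)) ≤ (m + 1) * p.coeff (m + 1) ^ 2 := by
  have h := laguerre (splits_iterate hp m)
  simp only [coeff_iterate_derivative, nsmul_eq_mul] at h
  have d0 : (0 + m).descFactorial m = m.factorial := by simp [Nat.descFactorial_self]
  have d1 : (1 + m).descFactorial m = (m + 1) * m.factorial := by
    have := Nat.factorial_mul_descFactorial (n := 1 + m) (k := m) (by omega)
    rw [show 1 + m - m = 1 by omega, show 1 + m = m + 1 by omega, Nat.factorial_succ m] at this
    rw [show 1 + m = m + 1 by omega]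
    simpa using this
  have d2 : 2 * (2 + m).descFactorial m = (m + 2) * ((m + 1) * m.factorial) := by
    have := Nat.factorial_mul_descFactorial (n := 2 + m) (k := m) (by omega)
    rw [show 2 + m - m = 2 by omega, show 2 + m = m + 1 + 1 by omega, Nat.factorial_succ (m + 1),
      Nat.factorial_succ m] at this
    rw [show 2 + m = m + 1 + 1 by omega]
    simpa using this
  have d2' : 2 * ((2 + m).descFactorial m : ℝ) = (m + 2) * ((m + 1) * m.factorial) := by
    exact_mod_cast d2
  rw [d0, d1, zero_add, add_comm 1 m, add_comm 2 m] at h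
  rw [add_comm 2 m] at d2'
  push_cast at h
  have hf : (0 : ℝ) < m.factorial := by exact_mod_cast m.factorial_pos
  have hpos : (0 : ℝ) < (m.factorial : ℝ) ^ 2 * (m + 1) := by positivity
  refine le_of_mul_le_mul_left ?_ hpos
  calc _ = (m.factorial : ℝ) * p.coeff m * p.coeff (m + 2) *
        ((m + 2) * ((m + 1) * m.factorial)) := by ring
    _ ≤ _ := by rw [← d2']; linarith

variable {ι : Type*} [DecidableEq ι]

/-- Elementary symmetric function of the entries indexed by `S`. -/
noncomputable def E (x : ι → ℝ) (m : ℕ) (S : Finset ι) : ℝ :=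
  ∑ s ∈ S.powersetCard m, ∏ i ∈ s, x i

lemma E_zero (x : ι → ℝ) (S : Finset ι) : E x 0 S = 1 := by simp [E]

lemma E_insert (x : ι → ℝ) (m : ℕ) {S : Finset ι} {a : ι} (ha : a ∉ S) :
    E x (m + 1) (insert a S) = E x (m + 1) S + x a * E x m S := by
  unfold E
  rw [powersetCard_succ_insert ha, sum_union, sum_image, mul_sum]
  · congr 1
    apply sum_congr rfl
    intro s hs
    rw [prod_insert]
    exact fun h => ha ((mem_powersetCard.1 hs).1 h)
  · intro s hs t ht hst
    have h1 : a ∉ s := fun h => ha ((mem_powersetCard.1 hs).1 h)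
    have h2 : a ∉ t := fun h => ha ((mem_powersetCard.1 ht).1 h)
    rw [← erase_insert h1, ← erase_insert h2, hst]
  · rw [disjoint_left]
    intro s hs hs'
    obtain ⟨t, -, rfl⟩ := mem_image.1 hs'
    exact ha ((mem_powersetCard.1 hs).1 (mem_insert_self _ _))

lemma E_erase (x : ι → ℝ) (m : ℕ) {S : Finset ι} {a : ι} (ha : a ∈ S) :
    E x (m + 1) S = E x (m + 1) (S.erase a) + x a * E x m (S.erase a) := by
  conv_lhs => rw [← insert_erase ha]
  exact E_insert x m (notMem_erase a S)

lemma newton (x : ι → ℝ) (j : ℕ) (S : Finset ι) (N : ℕ) (hN : S.card ≤ N) :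
    ((N : ℝ) + 1) * (E x j S * E x (j + 2) S) ≤ N * E x (j + 1) S ^ 2 := by
  by_cases hj : j + 2 ≤ S.card
  · obtain ⟨m, hm⟩ := Nat.exists_eq_add_of_le hj
    have hs : (∏ i ∈ S, (X + C (x i))).Splits :=
      Splits.prod fun i _ => Splits.X_add_C _
    have h := newton_poly hs m
    rw [prod_X_add_C_coeff S x (by omega), prod_X_add_C_coeff S x (by omega),
      prod_X_add_C_coeff S x (by omega), show S.card - m = j + 2 by omega,
      show S.card - (m + 2) = j by omega, show S.card - (m + 1) = j + 1 by omega] at h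
    change ((m : ℝ) + 2) * (E x (j + 2) S * E x j S) ≤ (m + 1) * E x (j + 1) S ^ 2 at h
    have hmN : (m : ℝ) + 1 ≤ N := by
      have : m + 1 ≤ N := by omega
      exact_mod_cast this
    have hm0 : (0 : ℝ) ≤ m := by positivity
    by_cases hp : 0 ≤ E x j S * E x (j + 2) S
    · have h3 : (E x j S * E x (j + 2) S) ≤ (m + 1) * (E x (j + 1) S ^ 2 - E x j S * E x (j + 2) S) := by
        linarith
      have h4 : 0 ≤ E x (j + 1) S ^ 2 - E x j S * E x (j + 2) S := by
        by_contra hc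
        push Not at hc
        nlinarith
      nlinarith [mul_le_mul_of_nonneg_right hmN h4]
    · push Not at hp
      have : 0 ≤ (N : ℝ) * E x (j + 1) S ^ 2 := by positivity
      nlinarith
  · have : E x (j + 2) S = 0 := by
      unfold E
      rw [powersetCard_eq_empty.2 (by omega), sum_empty]
    rw [this]
    simp only [mul_zero]
    positivity

lemma cone_erase (x : ι → ℝ) (k : ℕ) {S : Finset ι} (h : ∀ j ≤ k + 1, 0 < E x j S)
    {a : ι} (ha : a ∈ S) : ∀ j ≤ k, 0 < E x j (S.erase a) := by
  intro j
  induction j with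
  | zero => intro _; rw [E_zero]; norm_num
  | succ j ih =>
    intro hj
    have h0 := ih (by omega)
    have h1 := h (j + 1) (by omega)
    have h2 := h (j + 2) (by omega)
    rw [E_erase x _ ha] at h1 h2
    have hN := newton x j (S.erase a) _ le_rfl
    set N : ℝ := ((S.erase a).card : ℝ)
    have hN0 : 0 ≤ N := by positivity
    by_contra hc
    push Not at hc
    set p := E x j (S.erase a)
    set q := E x (j + 1) (S.erase a)
    set r := E x (j + 2) (S.erase a)
    have hx : 0 < x a := by
      by_contra hx; push Not at hx; nlinarith
    have hr : 0 < r := by nlinarith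
    have h3 : q ^ 2 ≤ p * r := by nlinarith
    have h4 : 0 < p * r := by positivity
    nlinarith

lemma sum_mul_E (x : ι → ℝ) (m : ℕ) (S : Finset ι) :
    ∑ i ∈ S, x i * E x m (S.erase i) = (m + 1) * E x (m + 1) S := by
  induction S using Finset.induction_on generalizing m with
  | empty =>
    have : E x (m + 1) (∅ : Finset ι) = 0 := by
      unfold E
      rw [powersetCard_eq_empty.2 (by simp), sum_empty]
    simp [this]
  | insert a T ha ih =>
    rw [sum_insert ha, erase_insert ha, E_insert x m ha]
    have hne : ∀ i ∈ T, (insert a T).erase i = insert a (T.erase i) := by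
      intro i hi
      rw [erase_insert_of_ne]
      rintro rfl; exact ha hi
    cases m with
    | zero =>
      have := ih 0
      simp only [E_zero] at *
      push_cast at *
      linarith
    | succ m =>
      have e : ∑ i ∈ T, x i * E x (m + 1) ((insert a T).erase i) =
          ∑ i ∈ T, x i * E x (m + 1) (T.erase i) + x a * ∑ i ∈ T, x i * E x m (T.erase i) := by
        rw [mul_sum, ← sum_add_distrib]
        apply sum_congr rfl
        intro i hi
        rw [hne i hi, E_insert x m (fun h => ha (mem_of_mem_erase h))]
        ring
      rw [e, ih, ih]
      push_cast
      ring

lemma sum_E (x : ι → ℝ) (m : ℕ) (S : Finset ι) :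
    ∑ i ∈ S, E x m (S.erase i) = (S.card - m) * E x m S := by
  cases m with
  | zero => simp [E_zero]
  | succ m =>
    have h := sum_mul_E x m S
    have : ∑ i ∈ S, E x (m + 1) S =
        ∑ i ∈ S, E x (m + 1) (S.erase i) + ∑ i ∈ S, x i * E x m (S.erase i) := by
      rw [← sum_add_distrib]
      exact sum_congr rfl fun i hi => E_erase x m hi
    rw [h, sum_const, nsmul_eq_mul] at this
    push_cast
    linarith

/-- The quadratic step. -/
lemma quad_step (N b0 b1 b2 l y : ℝ) (hN : 0 ≤ N) (h0 : 0 < b0) (hl : 0 < l) (hy : y ≤ l)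
    (hnewton : (N + 1) * (b0 * b2) ≤ N * b1 ^ 2)
    (hpos : 0 < b1 + l * b0)
    (hsig : 0 < b2 + (l + y) * b1 + l * y * b0) :
    l * b0 ≤ 2 * (N + 1) * (b1 + l * b0) := by
  by_contra hc
  push Not at hc
  set s := b1 + l * b0 with hs
  have hb1 : b1 = s - l * b0 := by rw [hs]; ring
  rw [hb1] at hnewton hsig
  have h1 : 0 < (N + 1) * (b0 * (b2 + (l + y) * (s - l * b0) + l * y * b0)) := by positivity
  have h2 : 0 < N * (s - l * b0) ^ 2 + (N + 1) * (b0 * ((l + y) * (s - l * b0) + l * y * b0)) := by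
    nlinarith
  have h3 : N * (s - l * b0) ^ 2 + (N + 1) * (b0 * ((l + y) * (s - l * b0) + l * y * b0))
      = N * s ^ 2 - (l * b0) ^ 2 + s * b0 * ((N + 1) * y + (1 - N) * l) := by ring
  rw [h3] at h2
  have h4 : s * b0 * ((N + 1) * y + (1 - N) * l) ≤ s * b0 * (2 * l) := by
    apply mul_le_mul_of_nonneg_left _ (by positivity)
    nlinarith
  have h5 : N * s ^ 2 ≤ N * s * (l * b0) := by
    have : s ≤ l * b0 := by nlinarith
    nlinarith [mul_le_mul_of_nonneg_left this (mul_nonneg hN hpos.le)]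
  have h6 : 0 < (l * b0) * ((N + 2) * s - l * b0) := by nlinarith
  have h7 : 0 < (N + 2) * s - l * b0 := pos_of_mul_pos_right h6 (by positivity)
  nlinarith

lemma main (x : ι → ℝ) (N : ℕ) (k : ℕ) : ∀ (S T : Finset ι) (p : ι), S.card ≤ N → T ⊆ S →
    T.card = k → p ∈ S → p ∉ T → (∀ a ∈ T, ∀ i ∈ S, i ∉ T → x i ≤ x a) →
    (∀ j ≤ k + 1, 0 < E x j S) →
    E x k S ≤ (2 * ((N : ℝ) + 1) ^ 2) ^ k * E x k (S.erase p) := by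
  induction k with
  | zero => intros; simp [E_zero]
  | succ k ih =>
    intro S T p hN hTS hTk hpS hpT hmax hcone
    have hTne : T.Nonempty := card_pos.1 (by omega)
    obtain ⟨a, haT, hamax⟩ := exists_max_image T x hTne
    have haS := hTS haT
    have hall : ∀ i ∈ S, x i ≤ x a := by
      intro i hi
      by_cases hiT : i ∈ T
      · exact hamax i hiT
      · exact hmax a haT i hi hiT
    have hpa : p ≠ a := by rintro rfl; exact hpT haT
    have hc1 := cone_erase x (k + 1) hcone haS
    have hcp := cone_erase x (k + 1) hcone hpS
    have hpSa : p ∈ S.erase a := mem_erase.2 ⟨hpa, hpS⟩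
    have haSp : a ∈ S.erase p := mem_erase.2 ⟨hpa.symm, haS⟩
    have hc2 := cone_erase x k hc1 hpSa
    have hIH := ih (S.erase a) (T.erase a) p ((card_le_card (erase_subset _ _)).trans hN)
      (erase_subset_erase _ hTS) (by rw [card_erase_of_mem haT]; omega) hpSa
      (fun h => hpT (mem_of_mem_erase h))
      (by
        intro b hb i hi hiT
        apply hmax b (mem_of_mem_erase hb) i (mem_of_mem_erase hi)
        intro h
        exact hiT (mem_erase.2 ⟨(mem_erase.1 hi).1, h⟩))
      hc1
    -- positivity of the largest entry
    have hxa : 0 < x a := by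
      by_contra hneg
      push Not at hneg
      have h := sum_mul_E x 0 S
      have h1 := hcone 1 (by omega)
      simp only [E_zero, mul_one] at h
      have h2 : ∑ i ∈ S, x i ≤ 0 := sum_nonpos fun i hi => (hall i hi).trans hneg
      push_cast at h
      simp only [zero_add, one_mul] at h
      linarith
    have hcomm : (S.erase p).erase a = (S.erase a).erase p := erase_right_comm
    set U := (S.erase a).erase p with hU
    have eP : E x (k + 1) (S.erase p) = E x (k + 1) U + x a * E x k U := by
      rw [E_erase x k haSp, hcomm]
    have hUN : U.card ≤ N :=
      (card_le_card ((erase_subset _ _).trans (erase_subset _ _))).trans hN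
    have hb0 := hc2 k le_rfl
    have hstep : x a * E x k U ≤ 2 * ((N : ℝ) + 1) * (E x (k + 1) U + x a * E x k U) := by
      apply quad_step N (E x k U) (E x (k + 1) U) (E x (k + 2) U) (x a) (x p) (by positivity) hb0
        hxa (hall p hpS) (newton x k U N hUN)
      · rw [← eP]; exact hcp (k + 1) le_rfl
      · have h := hcone (k + 2) (by omega)
        rw [E_erase x _ haS, E_erase x _ hpSa, E_erase x k hpSa] at h
        rw [← hU] at h
        linarith
    -- upper bound
    have hup : E x (k + 1) (S.erase a) ≤ N * (x a * E x k (S.erase a)) := by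
      have h1 := sum_mul_E x k (S.erase a)
      have h2 := sum_E x k (S.erase a)
      have h3 : ∑ i ∈ S.erase a, x i * E x k ((S.erase a).erase i) ≤
          x a * ∑ i ∈ S.erase a, E x k ((S.erase a).erase i) := by
        rw [mul_sum]
        apply sum_le_sum
        intro i hi
        exact mul_le_mul_of_nonneg_right (hall i (mem_of_mem_erase hi))
          (cone_erase x k hc1 hi k le_rfl).le
      rw [h1, h2] at h3
      have h4 := hc1 (k + 1) le_rfl
      have h5 := hc1 k (by omega)
      have h6 : ((S.erase a).card : ℝ) ≤ N := by
        exact_mod_cast (card_le_card (erase_subset _ _)).trans hN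
      have hk0 : (0 : ℝ) ≤ k := by positivity
      have h7 : 0 < x a * E x k (S.erase a) := by positivity
      nlinarith [mul_nonneg hk0 h4.le, mul_nonneg hk0 h7.le, mul_le_mul_of_nonneg_right h6 h7.le]
    rw [E_erase x k haS, eP, pow_succ]
    set M : ℝ := (2 * ((N : ℝ) + 1) ^ 2) ^ k
    have hM : 0 ≤ M := by positivity
    calc E x (k + 1) (S.erase a) + x a * E x k (S.erase a)
        ≤ (N + 1) * (x a * E x k (S.erase a)) := by linarith
      _ ≤ (N + 1) * (x a * (M * E x k U)) := by gcongr
      _ = (N + 1) * M * (x a * E x k U) := by ring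
      _ ≤ (N + 1) * M * (2 * ((N : ℝ) + 1) * (E x (k + 1) U + x a * E x k U)) := by gcongr
      _ = _ := by ring

end GardingAux

theorem stmt_0 (n k : ℕ) (hk1 : 1 ≤ k) (hkn : k ≤ n) :
    ∃ c : ℝ, 0 < c ∧
      ∀ η : Fin n → ℝ, η ∈ GardingCone n k →
        (∀ i j : Fin n, i ≤ j → η j ≤ η i) →
        c * ∑ i : Fin n, esymDel n (k - 1) η i ≤ esymDel n (k - 1) η ⟨k - 1, by omega⟩ := by
  obtain ⟨m, rfl⟩ : ∃ m, k = m + 1 := ⟨k - 1, by omega⟩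
  set M : ℝ := (2 * ((n : ℝ) + 1) ^ 2) ^ m with hM
  have hMpos : 0 < M := by positivity
  refine ⟨1 / (((n : ℝ) + 1) * M), by positivity, ?_⟩
  intro η hη hsort
  have hcone : ∀ j ≤ m + 1, 0 < GardingAux.E η j Finset.univ := by
    intro j hj
    rcases Nat.eq_zero_or_pos j with rfl | h
    · rw [GardingAux.E_zero]; norm_num
    · exact hη j h hj
  have hp : m < n := by omega
  have hmain := GardingAux.main η n m Finset.univ (Finset.univ.filter fun i : Fin n => (i : ℕ) < m)
    ⟨m, hp⟩ (by simp) (Finset.subset_univ _)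
    (by
      rw [Fin.card_filter_val_lt]
      omega)
    (Finset.mem_univ _) (by simp)
    (by
      intro a ha i _ hi
      simp at ha hi
      exact hsort a i (by rw [Fin.le_def]; omega))
    hcone
  have hsum := GardingAux.sum_E η m (Finset.univ : Finset (Fin n))
  have hpos := hcone m (by omega)
  change 1 / (((n : ℝ) + 1) * M) * ∑ i : Fin n, GardingAux.E η m (Finset.univ.erase i) ≤
    GardingAux.E η m (Finset.univ.erase ⟨m, hp⟩)
  rw [hsum, one_div, inv_mul_le_iff₀ (by positivity)]
  have hm0 : (0 : ℝ) ≤ m := by positivity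
  simp only [Finset.card_univ, Fintype.card_fin]
  calc ((n : ℝ) - m) * GardingAux.E η m Finset.univ
      ≤ (n + 1) * GardingAux.E η m Finset.univ := by
        apply mul_le_mul_of_nonneg_right _ hpos.le; linarith
    _ ≤ (n + 1) * (M * GardingAux.E η m (Finset.univ.erase ⟨m, hp⟩)) := by gcongr
    _ = _ := by ring
end

section
/- Key ellipticity lemma for Hessian-quotient-type operators: Let 1 ≤ l < k ≤ n−1. There exists a positive constant c_{n,k,l} depending only on n, k and l such that the following holds. Let λ = (λ_1,…,λ_n) ∈ ℝⁿ with λ_1 ≥ ⋯ ≥ λ_n, set η_i = Σ_{j=1}^n λ_j − λ_i (so that η_1 ≤ ⋯ ≤ η_n), and assume η ∈ Γ_{k+1}. Define f_i = (1/(k−l)) · (σ_k(η)/σ_l(η))^{1/(k−l) − 1} · Σ_{p≠i} (σ_{k−1}(η|p)·σ_l(η) − σ_k(η)·σ_{l−1}(η|p)) / σ_l(η)² for 1 ≤ i ≤ n. Then f_1 ≥ c_{n,k,l} · Σ_{i=1}^n f_i. -/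
open Polynomial in
theorem aux_laguerre (p : ℝ[X]) (hp : p.Splits) :
    2 * p.coeff 0 * p.coeff 2 ≤ p.coeff 1 ^ 2 := by
  obtain ⟨m, hm⟩ := splits_iff_exists_multiset'.mp hp
  have key : ∀ m : Multiset ℝ, 2 * ((m.map (X + C ·)).prod : ℝ[X]).coeff 0 *
      ((m.map (X + C ·)).prod : ℝ[X]).coeff 2 ≤ ((m.map (X + C ·)).prod : ℝ[X]).coeff 1 ^ 2 := by
    intro m
    induction m using Multiset.induction_on with
    | empty => simp [coeff_one]
    | cons a m ih =>
      rw [Multiset.map_cons, Multiset.prod_cons]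
      generalize (m.map (X + C ·)).prod = q at ih
      have h0 : ((X + C a) * q).coeff 0 = a * q.coeff 0 := by simp [add_mul]
      have h1 : ((X + C a) * q).coeff 1 = q.coeff 0 + a * q.coeff 1 := by
        rw [add_mul, coeff_add, coeff_C_mul, coeff_X_mul q 0]
      have h2 : ((X + C a) * q).coeff 2 = q.coeff 1 + a * q.coeff 2 := by
        rw [add_mul, coeff_add, coeff_C_mul, coeff_X_mul q 1]
      rw [h0, h1, h2]
      nlinarith [mul_le_mul_of_nonneg_left ih (sq_nonneg a), sq_nonneg (q.coeff 0)]
  have := key m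
  rw [hm]
  generalize (m.map (X + C ·)).prod = q at this
  simp only [coeff_C_mul]
  nlinarith [mul_le_mul_of_nonneg_left this (sq_nonneg p.leadingCoeff)]

open Polynomial in
theorem aux_splits_derivative (p : ℝ[X]) (hp : p.Splits) : (derivative p).Splits := by
  by_cases h0 : p.natDegree = 0
  · have : derivative p = 0 := by
      rw [eq_C_of_natDegree_eq_zero h0]; simp
    rw [this]; exact Splits.zero
  · rw [splits_iff_card_roots] at hp ⊢
    have h1 := card_roots_le_derivative p
    have h2 := natDegree_derivative_lt h0
    have h3 := card_roots' (derivative p)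
    omega

open Polynomial in
theorem aux_newton_poly (m : ℕ) : ∀ p : ℝ[X], p.Splits →
    ((m : ℝ) + 2) * (p.coeff m * p.coeff (m + 2)) ≤ ((m : ℝ) + 1) * p.coeff (m + 1) ^ 2 := by
  induction m with
  | zero => intro p hp; have := aux_laguerre p hp; simp; linarith
  | succ m ih =>
    intro p hp
    have := ih _ (aux_splits_derivative p hp)
    simp only [coeff_derivative] at this
    push_cast at this ⊢
    have e1 : m + 1 + 2 = m + 2 + 1 := by ring
    have e2 : m + 1 + 1 = m + 2 := by ring
    rw [e1] 
    rw [e2] at this ⊢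
    have hpos : (0 : ℝ) < (m + 1) * (m + 2) := by positivity
    refine le_of_mul_le_mul_left ?_ hpos
    nlinarith [this]

/-- elementary symmetric function over a finset. -/
noncomputable def auxE {ι : Type*} (x : ι → ℝ) (s : Finset ι) (m : ℕ) : ℝ :=
  ∑ t ∈ s.powersetCard m, ∏ i ∈ t, x i

section
variable {ι : Type*} [DecidableEq ι] (x : ι → ℝ)

theorem auxE_zero (s : Finset ι) : auxE x s 0 = 1 := by simp [auxE]

theorem auxE_insert (s : Finset ι) (a : ι) (ha : a ∉ s) (m : ℕ) :
    auxE x (insert a s) (m + 1) = auxE x s (m + 1) + x a * auxE x s m := by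
  unfold auxE
  rw [Finset.powersetCard_succ_insert ha, Finset.sum_union, Finset.sum_image, Finset.mul_sum]
  · congr 1
    refine Finset.sum_congr rfl fun t ht => ?_
    rw [Finset.prod_insert]
    exact fun h => ha ((Finset.mem_powersetCard.1 ht).1 h)
  · intro t ht u hu h
    have h1 : a ∉ t := fun h => ha ((Finset.mem_powersetCard.1 ht).1 h)
    have h2 : a ∉ u := fun h => ha ((Finset.mem_powersetCard.1 hu).1 h)
    rw [← Finset.erase_insert h1, ← Finset.erase_insert h2, h]
  · rw [Finset.disjoint_left]
    intro t ht h
    obtain ⟨u, _, rfl⟩ := Finset.mem_image.1 h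
    exact ha ((Finset.mem_powersetCard.1 ht).1 (Finset.mem_insert_self _ _))

theorem auxE_erase {s : Finset ι} {a : ι} (ha : a ∈ s) (m : ℕ) :
    auxE x s (m + 1) = auxE x (s.erase a) (m + 1) + x a * auxE x (s.erase a) m := by
  conv_lhs => rw [← Finset.insert_erase ha]
  exact auxE_insert x _ _ (Finset.notMem_erase _ _) m

open Polynomial in
theorem auxE_coeff (s : Finset ι) : ∀ m,
    (∏ i ∈ s, (1 + C (x i) * X : ℝ[X])).coeff m = auxE x s m := by
  induction s using Finset.induction_on with
  | empty =>
    intro m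
    cases m with
    | zero => simp [auxE]
    | succ m =>
      have : Finset.powersetCard (m + 1) (∅ : Finset ι) = ∅ :=
        Finset.powersetCard_eq_empty.2 (by simp)
      simp [auxE, coeff_one, this]
  | insert a s ha ih =>
    intro m
    rw [Finset.prod_insert ha, add_mul, one_mul, coeff_add, mul_assoc, coeff_C_mul]
    cases m with
    | zero => simp [ih, auxE_zero]
    | succ m => rw [coeff_X_mul, ih, ih, auxE_insert x s a ha]

open Polynomial in
theorem auxE_newton (s : Finset ι) (m : ℕ) :
    ((m : ℝ) + 2) * (auxE x s m * auxE x s (m + 2)) ≤ ((m : ℝ) + 1) * auxE x s (m + 1) ^ 2 := by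
  have := aux_newton_poly m (∏ i ∈ s, (1 + C (x i) * X : ℝ[X])) (by
    refine Splits.prod fun i _ => Splits.of_natDegree_le_one ?_
    compute_degree)
  simpa only [auxE_coeff] using this

theorem auxE_newton' (s : Finset ι) (m : ℕ) :
    auxE x s m * auxE x s (m + 2) ≤ auxE x s (m + 1) ^ 2 := by
  have h := auxE_newton x s m
  have hm : (0 : ℝ) ≤ m := by positivity
  by_contra! hc
  nlinarith [sq_nonneg (auxE x s (m + 1)), mul_nonneg hm (sub_nonneg.2 hc.le)]

/-- deletion maps the cone of order `K+1` to the one of order `K`. -/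
theorem auxE_cone {s : Finset ι} {a : ι} (ha : a ∈ s) (K : ℕ)
    (h : ∀ j ≤ K + 1, 0 < auxE x s j) : ∀ j ≤ K, 0 < auxE x (s.erase a) j := by
  intro j
  induction j with
  | zero => intro _; rw [auxE_zero]; exact one_pos
  | succ j ih =>
    intro hj
    have h0 := ih (by omega)
    have h1 := h (j + 1) (by omega)
    have h2 := h (j + 1 + 1) (by omega)
    rw [auxE_erase x ha] at h1 h2
    have hN := auxE_newton' x (s.erase a) j
    by_contra! hc
    change _ * auxE x (s.erase a) (j + 1 + 1) ≤ _ at hN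
    generalize auxE x (s.erase a) (j + 1 + 1) = w at *
    generalize auxE x (s.erase a) (j + 1) = v at *
    generalize auxE x (s.erase a) j = u at *
    have hx : 0 < x a := by
      by_contra! hx
      nlinarith [mul_nonneg_of_nonpos_of_nonpos hx (neg_nonpos.2 h0.le)]
    have hw : 0 < w := by nlinarith
    have : x a * (u * w) ≤ x a * v ^ 2 := mul_le_mul_of_nonneg_left hN hx.le
    nlinarith [mul_pos h1 hw, mul_nonneg (neg_nonneg.2 hc) h2.le]

theorem auxE_sum (s : Finset ι) (m : ℕ) :
    ∑ p ∈ s, auxE x (s.erase p) m = ((s.card : ℝ) - m) * auxE x s m := by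
  unfold auxE
  rw [Finset.sum_comm' (t' := s.powersetCard m) (s' := fun t => s \ t), Finset.mul_sum]
  · refine Finset.sum_congr rfl fun t ht => ?_
    obtain ⟨h1, h2⟩ := Finset.mem_powersetCard.1 ht
    rw [Finset.sum_const, Finset.card_sdiff_of_subset h1, nsmul_eq_mul,
      Nat.cast_sub (Finset.card_le_card h1), h2]
  · intro p t
    simp only [Finset.mem_powersetCard, Finset.subset_erase, Finset.mem_sdiff]
    tauto

/-- deleting the smallest entry loses only a constant factor. -/
theorem auxE_min {s : Finset ι} {q : ι} (hq : q ∈ s) (hmin : ∀ p ∈ s, x q ≤ x p) (m : ℕ)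
    (hm : m + 1 ≤ s.card) (h : ∀ j ≤ m + 1, 0 < auxE x s j) :
    auxE x s m ≤ s.card * auxE x (s.erase q) m := by
  have hle : ∀ p ∈ s, auxE x (s.erase p) m ≤ auxE x (s.erase q) m := by
    intro p hp
    cases m with
    | zero => simp [auxE_zero]
    | succ m =>
      by_cases hpq : p = q
      · rw [hpq]
      have hp' : p ∈ s.erase q := Finset.mem_erase.2 ⟨hpq, hp⟩
      have hq' : q ∈ s.erase p := Finset.mem_erase.2 ⟨Ne.symm hpq, hq⟩
      rw [auxE_erase x hp', auxE_erase x hq', Finset.erase_right_comm (s := s) (a := q)]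
      have := auxE_cone x hq' m (auxE_cone x hp (m + 1) h) m le_rfl
      nlinarith [hmin p hp]
  have h1 := auxE_sum x s m
  have h2 := Finset.sum_le_card_nsmul s _ _ hle
  rw [h1, nsmul_eq_mul] at h2
  have h3 := h m (by omega)
  have h4 : (1 : ℝ) ≤ (s.card : ℝ) - m := by
    have : ((m + 1 : ℕ) : ℝ) ≤ s.card := by exact_mod_cast hm
    push_cast at this; linarith
  nlinarith

theorem auxE_lower {s : Finset ι} {a : ι} (ha : a ∈ s) (m : ℕ)
    (h : ∀ j ≤ m + 1, 0 < auxE x s j) :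
    auxE x (s.erase a) m ≤ (m + 1) * auxE x s m := by
  have hb := auxE_cone x ha m h
  cases m with
  | zero => simp [auxE_zero]
  | succ m =>
    have h2 := h (m + 1 + 1) le_rfl
    have hN := auxE_newton x (s.erase a) m
    have hv := hb (m + 1) le_rfl
    have hu := hb m (by omega)
    rw [auxE_erase x ha] at h2 ⊢
    change _ * (_ * auxE x (s.erase a) (m + 1 + 1)) ≤ _ at hN
    generalize auxE x (s.erase a) (m + 1 + 1) = w at *
    generalize auxE x (s.erase a) (m + 1) = v at *
    generalize auxE x (s.erase a) m = u at *
    push_cast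
    refine le_of_mul_le_mul_left ?_ hv
    have hm : (0 : ℝ) ≤ (m : ℝ) + 2 := by positivity
    have := mul_nonneg hm (mul_nonneg hu.le h2.le)
    nlinarith

theorem aux_chain (e : ℕ → ℝ) (l d : ℕ) (hpos : ∀ j ≤ l + 2 + d, 0 < e j)
    (hN : ∀ m : ℕ, ((m : ℝ) + 2) * (e m * e (m + 2)) ≤ ((m : ℝ) + 1) * e (m + 1) ^ 2) :
    ((l : ℝ) + 2) * (e (l + 2 + d) * e l) ≤ ((l : ℝ) + 1) * (e (l + 1 + d) * e (l + 1)) := by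
  induction d with
  | zero => have := hN l; simp only [add_zero]; nlinarith
  | succ d ih =>
    have h1 := ih fun j hj => hpos j (by omega)
    have h2 := hN (l + 1 + d)
    have e1 : l + 2 + (d + 1) = l + 1 + d + 2 := by ring
    have e2 : l + 1 + (d + 1) = l + 1 + d + 1 := by ring
    have e3 : l + 2 + d = l + 1 + d + 1 := by ring
    have p0 := hpos l (by omega)
    have p1 := hpos (l + 1 + d) (by omega)
    have p2 := hpos (l + 1 + d + 1) (by omega)
    rw [e1, e2]
    rw [e3] at h1
    have h3 : e (l + 1 + d) * e (l + 1 + d + 2) ≤ e (l + 1 + d + 1) ^ 2 := by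
      have hm : (0 : ℝ) ≤ ((l + 1 + d : ℕ) : ℝ) := by positivity
      by_contra! hc
      nlinarith [sq_nonneg (e (l + 1 + d + 1)), mul_nonneg hm (sub_nonneg.2 hc.le)]
    generalize e (l + 1 + d + 2) = w at *
    generalize e (l + 1 + d + 1) = v at *
    generalize e (l + 1 + d) = u at *
    refine le_of_mul_le_mul_left ?_ p1
    have hl : (0 : ℝ) ≤ ((l : ℝ) + 2) * e l := by positivity
    nlinarith [mul_le_mul_of_nonneg_left h3 hl, mul_le_mul_of_nonneg_left h1 p2.le]

end

/-- numerator of the derivative of the quotient, with `l = l'+1`, `k = l'+2+d`. -/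
theorem aux_numer {n : ℕ} (x : Fin n → ℝ) (l d : ℕ) (p : Fin n) :
    auxE x (Finset.univ.erase p) (l + 1 + d) * auxE x Finset.univ (l + 1)
      - auxE x Finset.univ (l + 2 + d) * auxE x (Finset.univ.erase p) l
    = auxE x (Finset.univ.erase p) (l + 1 + d) * auxE x (Finset.univ.erase p) (l + 1)
      - auxE x (Finset.univ.erase p) (l + 2 + d) * auxE x (Finset.univ.erase p) l := by
  have e3 : l + 2 + d = l + 1 + d + 1 := by ring
  rw [e3, auxE_erase x (Finset.mem_univ p), auxE_erase x (Finset.mem_univ p)]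
  ring

theorem aux_main (n l d : ℕ) (hn : l + 3 + d ≤ n) (x : Fin n → ℝ)
    (h : ∀ j ≤ l + 3 + d, 0 < auxE x Finset.univ j) (a : Fin n) (g : Fin n → ℝ)
    (hg : ∀ p, g p = auxE x (Finset.univ.erase p) (l + 1 + d) * auxE x Finset.univ (l + 1)
      - auxE x Finset.univ (l + 2 + d) * auxE x (Finset.univ.erase p) l) :
    g a ≤ (n : ℝ) ^ 5 * ∑ p ∈ Finset.univ.erase a, g p := by
  have hcone : ∀ p, ∀ j ≤ l + 2 + d, 0 < auxE x (Finset.univ.erase p) j := fun p =>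
    auxE_cone x (Finset.mem_univ p) (l + 2 + d) (fun j hj => h j (by omega))
  have hcard : (Finset.univ.erase a).card = n - 1 := by
    rw [Finset.card_erase_of_mem (Finset.mem_univ a), Finset.card_univ, Fintype.card_fin]
  have hlow : ∀ p, auxE x (Finset.univ.erase p) (l + 1 + d) * auxE x (Finset.univ.erase p) (l + 1)
      ≤ n * g p := by
    intro p
    have h1 := aux_chain (auxE x (Finset.univ.erase p)) l d (hcone p)
      (auxE_newton x (Finset.univ.erase p))
    have h2 : 0 < auxE x (Finset.univ.erase p) (l + 1 + d) * auxE x (Finset.univ.erase p) (l + 1) :=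
      mul_pos (hcone p _ (by omega)) (hcone p _ (by omega))
    have h3 : 0 < auxE x (Finset.univ.erase p) (l + 2 + d) * auxE x (Finset.univ.erase p) l :=
      mul_pos (hcone p _ (by omega)) (hcone p _ (by omega))
    have hl : (l : ℝ) + 2 ≤ n := by exact_mod_cast (by omega : l + 2 ≤ n)
    rw [hg, aux_numer]
    have hl0 : (0 : ℝ) ≤ l := by positivity
    generalize auxE x (Finset.univ.erase p) (l + 1 + d) * auxE x (Finset.univ.erase p) (l + 1) = A at *
    generalize auxE x (Finset.univ.erase p) (l + 2 + d) * auxE x (Finset.univ.erase p) l = B at *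
    have hAB : 0 ≤ A - B := by
      by_contra! hc
      nlinarith
    nlinarith
  have hn0 : (0 : ℝ) < n := by exact_mod_cast (by omega : 0 < n)
  have hgpos : ∀ p, 0 ≤ g p := by
    intro p
    have h2 : 0 < auxE x (Finset.univ.erase p) (l + 1 + d) * auxE x (Finset.univ.erase p) (l + 1) :=
      mul_pos (hcone p _ (by omega)) (hcone p _ (by omega))
    have := h2.trans_le (hlow p)
    exact (pos_of_mul_pos_right this hn0.le).le
  obtain ⟨q, hq, hmin⟩ := Finset.exists_min_image (Finset.univ.erase a) x
    (Finset.card_pos.1 (by omega))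
  have hqa : q ≠ a := (Finset.mem_erase.1 hq).1
  have haq : a ∈ Finset.univ.erase q := Finset.mem_erase.2 ⟨hqa.symm, Finset.mem_univ _⟩
  have step : ∀ m ≤ l + 1 + d, auxE x (Finset.univ.erase a) m
      ≤ (n : ℝ) ^ 2 * auxE x (Finset.univ.erase q) m := by
    intro m hm
    have h1 := auxE_min x hq hmin m (by omega) (fun j hj => hcone a j (by omega))
    have h2 := auxE_lower x haq m (fun j hj => hcone q j (by omega))
    rw [Finset.erase_right_comm] at h2
    have h3 := hcone q m (by omega)
    have hc : ((Finset.univ.erase a).card : ℝ) ≤ n := by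
      exact_mod_cast (by omega : (Finset.univ.erase a).card ≤ n)
    have hm' : (m : ℝ) + 1 ≤ n := by exact_mod_cast (by omega : m + 1 ≤ n)
    calc _ ≤ _ := h1
      _ ≤ ((Finset.univ.erase a).card : ℝ) * ((m + 1) * auxE x (Finset.univ.erase q) m) := by gcongr
      _ ≤ n * (n * auxE x (Finset.univ.erase q) m) := by gcongr
      _ = _ := by ring
  have hga : g a ≤ auxE x (Finset.univ.erase a) (l + 1 + d) * auxE x (Finset.univ.erase a) (l + 1) := by
    rw [hg, aux_numer]
    have := mul_pos (hcone a (l + 2 + d) le_rfl) (hcone a l (by omega))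
    linarith
  have hS : g q ≤ ∑ p ∈ Finset.univ.erase a, g p :=
    Finset.single_le_sum (fun p _ => hgpos p) hq
  calc g a ≤ _ := hga
    _ ≤ ((n : ℝ) ^ 2 * auxE x (Finset.univ.erase q) (l + 1 + d)) *
        ((n : ℝ) ^ 2 * auxE x (Finset.univ.erase q) (l + 1)) :=
      mul_le_mul (step _ le_rfl) (step _ (by omega)) (hcone a _ (by omega)).le
        (mul_nonneg (by positivity) (hcone q _ (by omega)).le)
    _ = (n : ℝ) ^ 4 * (auxE x (Finset.univ.erase q) (l + 1 + d) *
          auxE x (Finset.univ.erase q) (l + 1)) := by ring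
    _ ≤ (n : ℝ) ^ 4 * (n * g q) := mul_le_mul_of_nonneg_left (hlow q) (by positivity)
    _ = (n : ℝ) ^ 5 * g q := by ring
    _ ≤ _ := by gcongr

/-- Key ellipticity lemma for Hessian-quotient-type operators. -/
theorem stmt_4 (n k l : ℕ) (hl1 : 1 ≤ l) (hlk : l < k) (hkn : k ≤ n - 1) :
    ∃ c : ℝ, 0 < c ∧
      ∀ lam η : Fin n → ℝ,
        (∀ i j : Fin n, i ≤ j → lam j ≤ lam i) →
        (∀ i : Fin n, η i = (∑ j : Fin n, lam j) - lam i) →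
        η ∈ GardingCone n (k + 1) →
        ∀ f : Fin n → ℝ,
          (∀ i : Fin n, f i =
            (1 / ((k : ℝ) - (l : ℝ))) *
              (esym n k η / esym n l η) ^ ((1 : ℝ) / ((k : ℝ) - (l : ℝ)) - 1) *
              ∑ p ∈ Finset.univ.erase i,
                (esymDel n (k - 1) η p * esym n l η - esym n k η * esymDel n (l - 1) η p) /
                  (esym n l η) ^ 2) →
          c * ∑ i : Fin n, f i ≤ f ⟨0, by omega⟩ := by
  obtain ⟨l, rfl⟩ : ∃ l', l = l' + 1 := ⟨l - 1, by omega⟩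
  obtain ⟨d, rfl⟩ : ∃ d, k = l + 2 + d := ⟨k - (l + 2), by omega⟩
  have hn : l + 3 + d ≤ n := by omega
  have hn1 : (0 : ℝ) < (n : ℝ) - 1 := by
    have : (1 : ℝ) < n := by exact_mod_cast (by omega : 1 < n)
    linarith
  refine ⟨1 / (((n : ℝ) - 1) * ((n : ℝ) ^ 5 + 1)), by positivity, ?_⟩
  intro lam η _ _ hη f hf
  have hpos : ∀ j ≤ l + 3 + d, 0 < auxE η Finset.univ j := by
    intro j hj
    rcases Nat.eq_zero_or_pos j with rfl | h0
    · rw [auxE_zero]; exact one_pos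
    · exact hη j h0 (by omega)
  set g : Fin n → ℝ := fun p => auxE η (Finset.univ.erase p) (l + 1 + d) * auxE η Finset.univ (l + 1)
      - auxE η Finset.univ (l + 2 + d) * auxE η (Finset.univ.erase p) l with hg
  have hmain := aux_main n l d hn η hpos ⟨0, by omega⟩ g (fun p => rfl)
  have hl : 0 < esym n (l + 1) η := hpos (l + 1) (by omega)
  have hk : 0 < esym n (l + 2 + d) η := hpos (l + 2 + d) (by omega)
  have hkl : (0 : ℝ) < ((l + 2 + d : ℕ) : ℝ) - ((l + 1 : ℕ) : ℝ) := by
    push_cast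
    have : (0 : ℝ) ≤ d := by positivity
    linarith
  obtain ⟨A, hA, hfA⟩ : ∃ A : ℝ, 0 < A ∧ ∀ i, f i = A * ∑ p ∈ Finset.univ.erase i, g p := by
    refine ⟨1 / (((l + 2 + d : ℕ) : ℝ) - ((l + 1 : ℕ) : ℝ)) *
      (esym n (l + 2 + d) η / esym n (l + 1) η) ^
        ((1 : ℝ) / (((l + 2 + d : ℕ) : ℝ) - ((l + 1 : ℕ) : ℝ)) - 1) / (esym n (l + 1) η) ^ 2,
      ?_, fun i => ?_⟩
    · have := Real.rpow_pos_of_pos (div_pos hk hl)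
        ((1 : ℝ) / (((l + 2 + d : ℕ) : ℝ) - ((l + 1 : ℕ) : ℝ)) - 1)
      positivity
    · rw [hf i, ← Finset.sum_div]
      have e1 : l + 2 + d - 1 = l + 1 + d := by omega
      rw [e1, Nat.add_sub_cancel]
      change _ * ((∑ p ∈ Finset.univ.erase i, g p) / _) = _
      ring
  have hsum : ∀ i, ∑ p ∈ Finset.univ.erase i, g p = (∑ p, g p) - g i := by
    intro i
    rw [Finset.sum_erase_eq_sub (Finset.mem_univ i)]
  have htot : ∑ i, f i = A * (((n : ℝ) - 1) * ∑ p, g p) := by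
    simp only [hfA, hsum]
    rw [← Finset.mul_sum, Finset.sum_sub_distrib, Finset.sum_const, Finset.card_univ,
      Fintype.card_fin, nsmul_eq_mul]
    ring
  rw [htot, hfA, div_mul_eq_mul_div, one_mul, div_le_iff₀ (by positivity)]
  have h1 := hsum ⟨0, by omega⟩
  have h2 : ∑ p, g p ≤ ((n : ℝ) ^ 5 + 1) * ∑ p ∈ Finset.univ.erase ⟨0, by omega⟩, g p := by
    linarith
  calc _ ≤ A * (((n : ℝ) - 1) * (((n : ℝ) ^ 5 + 1) *
        ∑ p ∈ Finset.univ.erase ⟨0, by omega⟩, g p)) := by gcongr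
    _ = _ := by ring
end
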